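/- Let (X,T) be a nonautonomous dynamical system, K ⊂ X_0 a non-empty compact set, f = (f_k) a sequence of continuous real-valued potentials, and suppose that W^s_{N,ε}(T,f,χ_K) > 0 for some s ∈ ℝ, N > 0 and ε > 0. Then there exists a Borel probability measure μ on X_0 and a constant C > 0 such that μ(K) = 1 and, for all x ∈ X_0 and all integers n ≥ N, μ(B_n^T(x,ε)) ≤ (1/C) exp(−sn + sup_{y ∈ B_n^T(x,ε)} S_n^T f(y)). -/

import Mathlib

open Filter MeasureTheory Set
open scoped ENNReal Topology

namespace NDS

variable {X : ℕ → Type*}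

/-- Iterates `T^j : X 0 → X j` of a nonautonomous dynamical system `T`. -/
def iter (T : ∀ k, X k → X (k + 1)) : ∀ j, X 0 → X j
  | 0 => fun x => x
  | j + 1 => fun x => T j (iter T j x)

/-- The Birkhoff-type sum `S_n^T f (x) = ∑_{j<n} f_j (T^j x)`. -/
def birk (T : ∀ k, X k → X (k + 1)) (f : ∀ k, X k → ℝ) (n : ℕ) (x : X 0) : ℝ :=
  ∑ j ∈ Finset.range n, f j (iter T j x)

/-- The uniform norm `‖f‖ = sup_k sup_x |f_k x|` of a sequence of potentials. -/
noncomputable def fnorm (f : ∀ k, X k → ℝ) : ℝ :=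
  ⨆ k : ℕ, ⨆ x : X k, |f k x|

/-- `log : ℝ≥0∞ → EReal` with the conventions `log 0 = -∞`, `log ∞ = ∞`. -/
noncomputable def elog (x : ℝ≥0∞) : EReal :=
  if x = 0 then ⊥ else if x = ⊤ then ⊤ else ((Real.log x.toReal : ℝ) : EReal)

/-- The nonnegative part of an extended real, as an element of `ℝ≥0∞`. -/
noncomputable def toENN (x : EReal) : ℝ≥0∞ :=
  if x = ⊤ then ⊤ else ENNReal.ofReal x.toReal

/-- The canonical map `ℝ≥0∞ → EReal`. -/
noncomputable def ofENN (x : ℝ≥0∞) : EReal :=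
  if x = ⊤ then ⊤ else ((x.toReal : ℝ) : EReal)

/-- The integral of an extended-real-valued function: the difference of the lower
integrals of its positive and negative parts. -/
noncomputable def eInt {α : Type*} [MeasurableSpace α] (μ : Measure α) (g : α → EReal) : EReal :=
  ofENN (∫⁻ x, toENN (g x) ∂μ) - ofENN (∫⁻ x, toENN (-g x) ∂μ)

section Metric

variable [∀ k, MetricSpace (X k)]

/-- The open Bowen ball `B_n^T(x,ε)`. -/
def bowenBall (T : ∀ k, X k → X (k + 1)) (n : ℕ) (ε : ℝ) (x : X 0) : Set (X 0) :=
  {y | ∀ j < n, dist (iter T j x) (iter T j y) < ε}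

/-- The closed Bowen ball `B̄_n^T(x,ε)`. -/
def bowenClosedBall (T : ∀ k, X k → X (k + 1)) (n : ℕ) (ε : ℝ) (x : X 0) : Set (X 0) :=
  {y | ∀ j < n, dist (iter T j x) (iter T j y) ≤ ε}

/-- Equicontinuity of a sequence of potentials `f = (f_k)`. -/
def EquicontPotential (f : ∀ k, X k → ℝ) : Prop :=
  ∀ ε : ℝ, 0 < ε → ∃ δ : ℝ, 0 < δ ∧ ∀ k, ∀ x y : X k, dist x y < δ → |f k x - f k y| < ε

/-- The supremum of the Birkhoff sum `S_n^T f` over a subset `A` of `X 0`. -/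
noncomputable def supBirk (T : ∀ k, X k → X (k + 1)) (f : ∀ k, X k → ℝ) (n : ℕ)
    (A : Set (X 0)) : ℝ :=
  ⨆ y : A, birk T f n (y : X 0)

/-- Measure-theoretic lower local pressure `P̲_μ(T,f,x)`. -/
noncomputable def localLowerPres [MeasurableSpace (X 0)] (μ : Measure (X 0))
    (T : ∀ k, X k → X (k + 1)) (f : ∀ k, X k → ℝ) (x : X 0) : EReal :=
  ⨆ (ε : ℝ) (_ : 0 < ε),
    liminf (fun n : ℕ =>
      (((n : ℝ)⁻¹ : ℝ) : EReal) *
        (-(elog (μ (bowenBall T n ε x))) + ((birk T f n x : ℝ) : EReal))) atTop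

/-- Measure-theoretic upper local pressure `P̄_μ(T,f,x)`. -/
noncomputable def localUpperPres [MeasurableSpace (X 0)] (μ : Measure (X 0))
    (T : ∀ k, X k → X (k + 1)) (f : ∀ k, X k → ℝ) (x : X 0) : EReal :=
  ⨆ (ε : ℝ) (_ : 0 < ε),
    limsup (fun n : ℕ =>
      (((n : ℝ)⁻¹ : ℝ) : EReal) *
        (-(elog (μ (bowenBall T n ε x))) + ((birk T f n x : ℝ) : EReal))) atTop

/-- Measure-theoretic lower local entropy `h̲_μ(T,x)`. -/
noncomputable def localLowerEnt [MeasurableSpace (X 0)] (μ : Measure (X 0))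
    (T : ∀ k, X k → X (k + 1)) (x : X 0) : EReal :=
  ⨆ (ε : ℝ) (_ : 0 < ε),
    liminf (fun n : ℕ =>
      (((n : ℝ)⁻¹ : ℝ) : EReal) * (-(elog (μ (bowenBall T n ε x))))) atTop

/-- Measure-theoretic upper local entropy `h̄_μ(T,x)`. -/
noncomputable def localUpperEnt [MeasurableSpace (X 0)] (μ : Measure (X 0))
    (T : ∀ k, X k → X (k + 1)) (x : X 0) : EReal :=
  ⨆ (ε : ℝ) (_ : 0 < ε),
    limsup (fun n : ℕ =>
      (((n : ℝ)⁻¹ : ℝ) : EReal) * (-(elog (μ (bowenBall T n ε x))))) atTop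

/-- Measure-theoretic lower pressure `P̲_μ(T,f) = ∫ P̲_μ(T,f,x) dμ(x)`. -/
noncomputable def lowerPres [MeasurableSpace (X 0)] (μ : Measure (X 0))
    (T : ∀ k, X k → X (k + 1)) (f : ∀ k, X k → ℝ) : EReal :=
  eInt μ (fun x => localLowerPres μ T f x)

/-- Measure-theoretic upper pressure `P̄_μ(T,f) = ∫ P̄_μ(T,f,x) dμ(x)`. -/
noncomputable def upperPres [MeasurableSpace (X 0)] (μ : Measure (X 0))
    (T : ∀ k, X k → X (k + 1)) (f : ∀ k, X k → ℝ) : EReal :=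
  eInt μ (fun x => localUpperPres μ T f x)

/-- Measure-theoretic lower entropy `h̲_μ(T) = ∫ h̲_μ(T,x) dμ(x)`. -/
noncomputable def lowerEnt [MeasurableSpace (X 0)] (μ : Measure (X 0))
    (T : ∀ k, X k → X (k + 1)) : EReal :=
  eInt μ (fun x => localLowerEnt μ T x)

/-- Measure-theoretic upper entropy `h̄_μ(T) = ∫ h̄_μ(T,x) dμ(x)`. -/
noncomputable def upperEnt [MeasurableSpace (X 0)] (μ : Measure (X 0))
    (T : ∀ k, X k → X (k + 1)) : EReal :=
  eInt μ (fun x => localUpperEnt μ T x)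

/-- The Bowen premeasure `M^s_{N,ε}(T,f,Z)`: the infimum of
`∑ exp(-n_i s + S_{n_i}^T f(x_i))` over all countable `(N,ε)`-covers of `Z` by open
Bowen balls `B_{n_i}^T(x_i,ε)` with `n_i ≥ N`. -/
noncomputable def bowenPre (T : ∀ k, X k → X (k + 1)) (f : ∀ k, X k → ℝ)
    (s : ℝ) (N : ℕ) (ε : ℝ) (Z : Set (X 0)) : ℝ≥0∞ :=
  ⨅ (D : Set (X 0 × ℕ)) (_ : D.Countable) (_ : ∀ p ∈ D, N ≤ p.2)
      (_ : Z ⊆ ⋃ p ∈ D, bowenBall T p.2 ε p.1),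
    ∑' p : D, ENNReal.ofReal (Real.exp (-(p.1.2 : ℝ) * s + birk T f p.1.2 p.1.1))

/-- `M^s_ε(T,f,Z) = lim_{N→∞} M^s_{N,ε}(T,f,Z)` (an increasing limit). -/
noncomputable def bowenPreLim (T : ∀ k, X k → X (k + 1)) (f : ∀ k, X k → ℝ)
    (s : ℝ) (ε : ℝ) (Z : Set (X 0)) : ℝ≥0∞ :=
  ⨆ N : ℕ, bowenPre T f s N ε Z

/-- The critical value `P^B(T,f,Z,ε) = inf {s : M^s_ε(T,f,Z) = 0}`. -/
noncomputable def bowenCrit (T : ∀ k, X k → X (k + 1)) (f : ∀ k, X k → ℝ)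
    (ε : ℝ) (Z : Set (X 0)) : EReal :=
  ⨅ (s : ℝ) (_ : bowenPreLim T f s ε Z = 0), (s : EReal)

/-- The Bowen (Pesin–Pitskel') topological pressure
`P^B(T,f,Z) = lim_{ε→0} P^B(T,f,Z,ε)` (an increasing limit as `ε ↓ 0`). -/
noncomputable def bowenP (T : ∀ k, X k → X (k + 1)) (f : ∀ k, X k → ℝ)
    (Z : Set (X 0)) : EReal :=
  ⨆ (ε : ℝ) (_ : 0 < ε), bowenCrit T f ε Z

/-- The Bowen topological entropy `h^B(T,Z) = P^B(T,0,Z)`. -/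
noncomputable def bowenEnt (T : ∀ k, X k → X (k + 1)) (Z : Set (X 0)) : EReal :=
  bowenP T (fun k => fun _ : X k => (0 : ℝ)) Z

/-- The premeasure `N^s_{N,ε}(T,f,Z)` using suprema of Birkhoff sums over the balls. -/
noncomputable def nBowenPre (T : ∀ k, X k → X (k + 1)) (f : ∀ k, X k → ℝ)
    (s : ℝ) (N : ℕ) (ε : ℝ) (Z : Set (X 0)) : ℝ≥0∞ :=
  ⨅ (D : Set (X 0 × ℕ)) (_ : D.Countable) (_ : ∀ p ∈ D, N ≤ p.2)
      (_ : Z ⊆ ⋃ p ∈ D, bowenBall T p.2 ε p.1),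
    ∑' p : D, ENNReal.ofReal
      (Real.exp (-(p.1.2 : ℝ) * s + supBirk T f p.1.2 (bowenBall T p.1.2 ε p.1.1)))

/-- `N^s_ε(T,f,Z) = lim_{N→∞} N^s_{N,ε}(T,f,Z)`. -/
noncomputable def nBowenPreLim (T : ∀ k, X k → X (k + 1)) (f : ∀ k, X k → ℝ)
    (s : ℝ) (ε : ℝ) (Z : Set (X 0)) : ℝ≥0∞ :=
  ⨆ N : ℕ, nBowenPre T f s N ε Z

/-- The critical value `Q^B(T,f,Z,ε) = inf {s : N^s_ε(T,f,Z) = 0}`. -/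
noncomputable def nBowenCrit (T : ∀ k, X k → X (k + 1)) (f : ∀ k, X k → ℝ)
    (ε : ℝ) (Z : Set (X 0)) : EReal :=
  ⨅ (s : ℝ) (_ : nBowenPreLim T f s ε Z = 0), (s : EReal)

/-- The weighted Bowen premeasure `W^s_{N,ε}(T,f,g)`: the infimum of
`∑ c_i exp(-n_i s + sup_{B_{n_i}^T(x_i,ε)} S_{n_i}^T f)` over all countable families
`{(B_{n_i}^T(x_i,ε), c_i)}` with `0 < c_i`, `n_i ≥ N` and `∑ c_i χ_{B_i} ≥ g`. -/
noncomputable def wBowenPre (T : ∀ k, X k → X (k + 1)) (f : ∀ k, X k → ℝ)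
    (s : ℝ) (N : ℕ) (ε : ℝ) (g : X 0 → ℝ) : ℝ≥0∞ :=
  ⨅ (D : Set ((X 0 × ℕ) × ℝ)) (_ : D.Countable)
      (_ : ∀ p ∈ D, N ≤ p.1.2 ∧ 0 < p.2)
      (_ : ∀ x : X 0, ENNReal.ofReal (g x) ≤
        ∑' p : D, (bowenBall T p.1.1.2 ε p.1.1.1).indicator
          (fun _ => ENNReal.ofReal p.1.2) x),
    ∑' p : D, ENNReal.ofReal p.1.2 *
      ENNReal.ofReal
        (Real.exp (-(p.1.1.2 : ℝ) * s + supBirk T f p.1.1.2 (bowenBall T p.1.1.2 ε p.1.1.1)))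

/-- `D` is a countable `(N,ε)`-packing of `Z`: the closed Bowen balls
`B̄_{n}^T(x,ε)`, `(x,n) ∈ D`, are pairwise disjoint with centers in `Z` and orders `≥ N`. -/
def IsPacking (T : ∀ k, X k → X (k + 1)) (N : ℕ) (ε : ℝ) (Z : Set (X 0))
    (D : Set (X 0 × ℕ)) : Prop :=
  D.Countable ∧ (∀ p ∈ D, p.1 ∈ Z ∧ N ≤ p.2) ∧
    ∀ p ∈ D, ∀ q ∈ D, p ≠ q →
      Disjoint (bowenClosedBall T p.2 ε p.1) (bowenClosedBall T q.2 ε q.1)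

/-- The packing premeasure `P^s_{N,ε}(T,f,Z)`: the supremum of
`∑ exp(-n_i s + S_{n_i}^T f(x_i))` over all countable `(N,ε)`-packings of `Z`. -/
noncomputable def packPre (T : ∀ k, X k → X (k + 1)) (f : ∀ k, X k → ℝ)
    (s : ℝ) (N : ℕ) (ε : ℝ) (Z : Set (X 0)) : ℝ≥0∞ :=
  ⨆ (D : Set (X 0 × ℕ)) (_ : IsPacking T N ε Z D),
    ∑' p : D, ENNReal.ofReal (Real.exp (-(p.1.2 : ℝ) * s + birk T f p.1.2 p.1.1))

/-- `P^s_{∞,ε}(T,f,Z) = lim_{N→∞} P^s_{N,ε}(T,f,Z)` (a decreasing limit). -/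
noncomputable def packPreInf (T : ∀ k, X k → X (k + 1)) (f : ∀ k, X k → ℝ)
    (s : ℝ) (ε : ℝ) (Z : Set (X 0)) : ℝ≥0∞ :=
  ⨅ N : ℕ, packPre T f s N ε Z

/-- The packing measure-like quantity
`P^s_ε(T,f,Z) = inf { ∑_i P^s_{∞,ε}(T,f,Z_i) : Z ⊆ ⋃_i Z_i }`. -/
noncomputable def packMeasure (T : ∀ k, X k → X (k + 1)) (f : ∀ k, X k → ℝ)
    (s : ℝ) (ε : ℝ) (Z : Set (X 0)) : ℝ≥0∞ :=
  ⨅ (Zs : ℕ → Set (X 0)) (_ : Z ⊆ ⋃ i, Zs i), ∑' i, packPreInf T f s ε (Zs i)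

/-- The critical value `P^P(T,f,Z,ε) = inf {s : P^s_ε(T,f,Z) = 0}`. -/
noncomputable def packCrit (T : ∀ k, X k → X (k + 1)) (f : ∀ k, X k → ℝ)
    (ε : ℝ) (Z : Set (X 0)) : EReal :=
  ⨅ (s : ℝ) (_ : packMeasure T f s ε Z = 0), (s : EReal)

/-- The packing topological pressure `P^P(T,f,Z) = lim_{ε→0} P^P(T,f,Z,ε)`. -/
noncomputable def packP (T : ∀ k, X k → X (k + 1)) (f : ∀ k, X k → ℝ)
    (Z : Set (X 0)) : EReal :=
  ⨆ (ε : ℝ) (_ : 0 < ε), packCrit T f ε Z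

/-- The packing topological entropy `h^P(T,Z) = P^P(T,0,Z)`. -/
noncomputable def packEnt (T : ∀ k, X k → X (k + 1)) (Z : Set (X 0)) : EReal :=
  packP T (fun k => fun _ : X k => (0 : ℝ)) Z

/-- The packing premeasure `Q^s_{N,ε}(T,f,Z)` using suprema of Birkhoff sums over the balls. -/
noncomputable def qPackPre (T : ∀ k, X k → X (k + 1)) (f : ∀ k, X k → ℝ)
    (s : ℝ) (N : ℕ) (ε : ℝ) (Z : Set (X 0)) : ℝ≥0∞ :=
  ⨆ (D : Set (X 0 × ℕ)) (_ : IsPacking T N ε Z D),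
    ∑' p : D, ENNReal.ofReal
      (Real.exp (-(p.1.2 : ℝ) * s + supBirk T f p.1.2 (bowenClosedBall T p.1.2 ε p.1.1)))

/-- `Q^s_{∞,ε}(T,f,Z) = lim_{N→∞} Q^s_{N,ε}(T,f,Z)`. -/
noncomputable def qPackPreInf (T : ∀ k, X k → X (k + 1)) (f : ∀ k, X k → ℝ)
    (s : ℝ) (ε : ℝ) (Z : Set (X 0)) : ℝ≥0∞ :=
  ⨅ N : ℕ, qPackPre T f s N ε Z

/-- `Q^s_ε(T,f,Z) = inf { ∑_i Q^s_{∞,ε}(T,f,Z_i) : Z ⊆ ⋃_i Z_i }`. -/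
noncomputable def qPackMeasure (T : ∀ k, X k → X (k + 1)) (f : ∀ k, X k → ℝ)
    (s : ℝ) (ε : ℝ) (Z : Set (X 0)) : ℝ≥0∞ :=
  ⨅ (Zs : ℕ → Set (X 0)) (_ : Z ⊆ ⋃ i, Zs i), ∑' i, qPackPreInf T f s ε (Zs i)

/-- The critical value `Q^P(T,f,Z,ε) = inf {s : Q^s_ε(T,f,Z) = 0}`. -/
noncomputable def qPackCrit (T : ∀ k, X k → X (k + 1)) (f : ∀ k, X k → ℝ)
    (ε : ℝ) (Z : Set (X 0)) : EReal :=
  ⨅ (s : ℝ) (_ : qPackMeasure T f s ε Z = 0), (s : EReal)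

end Metric

/-- The distance function of an explicitly given metric space structure. -/
def mdist {α : Type*} (m : MetricSpace α) (x y : α) : ℝ :=
  @dist α m.toPseudoMetricSpace.toDist x y

end NDS

/-- The fractional covering number of `g` (more precisely, of its nonnegative part) by the
sets `U i` with costs `a i`. -/
noncomputable def fracCover {Y ι : Type*} (U : ι → Set Y) (a : ι → ℝ≥0∞) (g : Y → ℝ) : ℝ≥0∞ :=
  ⨅ (c : ι → ℝ≥0∞)
    (_ : ∀ x, ENNReal.ofReal (g x) ≤ ∑' i, (U i).indicator (fun _ => c i) x),
    ∑' i, c i * a i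

section FracCover

variable {Y ι : Type*} {U : ι → Set Y} {a : ι → ℝ≥0∞}

lemma fracCover_le {g : Y → ℝ} (c : ι → ℝ≥0∞)
    (hc : ∀ x, ENNReal.ofReal (g x) ≤ ∑' i, (U i).indicator (fun _ => c i) x) :
    fracCover U a g ≤ ∑' i, c i * a i :=
  iInf₂_le c hc

lemma fracCover_of_nonpos {g : Y → ℝ} (hg : ∀ x, g x ≤ 0) : fracCover U a g = 0 :=
  nonpos_iff_eq_zero.1 <| (fracCover_le (fun _ => 0) fun x => by
    simp [ENNReal.ofReal_of_nonpos (hg x)]).trans (by simp)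

lemma fracCover_add_le (g h : Y → ℝ) :
    fracCover U a (g + h) ≤ fracCover U a g + fracCover U a h := by
  conv_rhs => simp only [fracCover, ENNReal.iInf_add, ENNReal.add_iInf]
  refine le_iInf₂ fun c hc => le_iInf₂ fun d hd => ?_
  rw [← ENNReal.tsum_add]
  simp_rw [← add_mul]
  refine fracCover_le (fun i => d i + c i) fun x => ?_
  simp_rw [indicator_add, ENNReal.tsum_add]
  exact ENNReal.ofReal_add_le.trans (add_le_add (hd x) (hc x))

lemma fracCover_const_mul_le {t : ℝ} (ht : 0 < t) (g : Y → ℝ) :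
    fracCover U a (fun x => t * g x) ≤ ENNReal.ofReal t * fracCover U a g := by
  have h0 : ENNReal.ofReal t ≠ 0 := by simpa using ht
  simp only [fracCover, ENNReal.mul_iInf_of_ne h0 ENNReal.ofReal_ne_top]
  refine le_iInf₂ fun c hc => ?_
  rw [← ENNReal.tsum_mul_left]
  simp_rw [← mul_assoc]
  refine fracCover_le (fun i => ENNReal.ofReal t * c i) fun x => ?_
  simp_rw [indicator_const_mul, ENNReal.tsum_mul_left, ENNReal.ofReal_mul ht.le]
  gcongr
  exact hc x

lemma fracCover_const_mul {t : ℝ} (ht : 0 < t) (g : Y → ℝ) :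
    fracCover U a (fun x => t * g x) = ENNReal.ofReal t * fracCover U a g := by
  refine (fracCover_const_mul_le ht g).antisymm ?_
  have h := fracCover_const_mul_le (U := U) (a := a) (inv_pos.2 ht) (fun x => t * g x)
  simp only [inv_mul_cancel_left₀ ht.ne'] at h
  calc ENNReal.ofReal t * fracCover U a g
      ≤ ENNReal.ofReal t * (ENNReal.ofReal t⁻¹ * fracCover U a fun x => t * g x) := by gcongr
    _ = fracCover U a fun x => t * g x := by
      rw [← mul_assoc, ← ENNReal.ofReal_mul ht.le, mul_inv_cancel₀ ht.ne', ENNReal.ofReal_one,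
        one_mul]

lemma fracCover_le_of_indicator (i : ι) {g : Y → ℝ} (h1 : ∀ x, g x ≤ 1)
    (hU : ∀ x ∉ U i, g x ≤ 0) : fracCover U a g ≤ a i := by
  classical
  refine (fracCover_le (Pi.single i 1) fun x => ?_).trans ?_
  · by_cases hx : x ∈ U i
    · calc ENNReal.ofReal (g x) ≤ (U i).indicator (fun _ => (Pi.single i 1 : ι → ℝ≥0∞) i) x := by
            simpa [hx] using h1 x
        _ ≤ _ := ENNReal.le_tsum (f := fun j =>
            (U j).indicator (fun _ => (Pi.single i 1 : ι → ℝ≥0∞) j) x) i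
    · simp [ENNReal.ofReal_of_nonpos (hU x hx)]
  · rw [tsum_eq_single i fun j hj => by simp [hj]]
    simp

variable [TopologicalSpace Y] [CompactSpace Y]

lemma fracCover_ne_top (hU : ∀ i, IsOpen (U i)) (hcov : ⋃ i, U i = univ) (ha : ∀ i, a i ≠ ⊤)
    {g : Y → ℝ} (hg : Continuous g) : fracCover U a g ≠ ⊤ := by
  classical
  obtain ⟨t, ht⟩ := isCompact_univ.elim_finite_subcover U hU hcov.ge
  obtain ⟨M, hM⟩ := (isCompact_range hg).bddAbove
  refine ne_top_of_le_ne_top ?_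
    (fracCover_le (fun i => if i ∈ t then ENNReal.ofReal M else 0) fun x => ?_)
  · rw [tsum_eq_sum (s := t) fun i hi => by simp [hi]]
    refine ENNReal.sum_ne_top.2 fun i hi => ?_
    simpa [hi] using ENNReal.mul_ne_top ENNReal.ofReal_ne_top (ha i)
  · obtain ⟨i, hi, hx⟩ := mem_iUnion₂.1 (ht (mem_univ x))
    calc ENNReal.ofReal (g x) ≤ ENNReal.ofReal M := by gcongr; exact hM (mem_range_self x)
      _ = (U i).indicator (fun _ => if i ∈ t then ENNReal.ofReal M else 0) x := by simp [hx, hi]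
      _ ≤ _ := ENNReal.le_tsum (f := fun i =>
          (U i).indicator (fun _ => if i ∈ t then ENNReal.ofReal M else 0) x) i

open scoped CompactlySupported in
/-- Linear programming duality for fractional open covers of a compact space: some Borel measure
has total mass the fractional covering number and charges each covering set at most its cost. -/
theorem exists_measure_univ_eq_fracCover [Nonempty Y] [T2Space Y] [MeasurableSpace Y]
    [BorelSpace Y] (hU : ∀ i, IsOpen (U i)) (hcov : ⋃ i, U i = univ) (ha : ∀ i, a i ≠ ⊤) :
    ∃ μ : Measure Y, μ univ = fracCover U a (fun _ => 1) ∧ ∀ i, μ (U i) ≤ a i := by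
  have hfin (g : C_c(Y, ℝ)) : fracCover U a g ≠ ⊤ :=
    fracCover_ne_top hU hcov ha g.continuous
  let p : C_c(Y, ℝ) → ℝ := fun g => (fracCover U a g).toReal
  have p_smul (t : ℝ) (ht : 0 < t) (g : C_c(Y, ℝ)) : p (t • g) = t * p g := by
    have h : ⇑(t • g) = fun x => t * g x := by ext; simp
    simp only [p, h, fracCover_const_mul ht, ENNReal.toReal_mul, ENNReal.toReal_ofReal ht.le]
  have p_add (g h : C_c(Y, ℝ)) : p (g + h) ≤ p g + p h := by
    simp only [p]
    rw [← ENNReal.toReal_add (hfin g) (hfin h)]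
    exact ENNReal.toReal_mono (ENNReal.add_ne_top.2 ⟨hfin g, hfin h⟩)
      (fracCover_add_le (⇑g) (⇑h))
  have p_nonpos {g : C_c(Y, ℝ)} (hg : ∀ x, g x ≤ 0) : p g = 0 := by
    simp [p, fracCover_of_nonpos hg]
  let e : C_c(Y, ℝ) := CompactlySupportedContinuousMap.continuousMapEquiv (1 : C(Y, ℝ))
  have he (x : Y) : e x = 1 := rfl
  have he0 : e ≠ 0 := fun h => by
    simpa [he] using DFunLike.congr_fun h (Classical.arbitrary Y)
  obtain ⟨L, hLe, hLp⟩ := exists_extension_of_le_sublinear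
    (LinearPMap.mkSpanSingleton (σ := RingHom.id ℝ) e (p e) he0) p p_smul p_add (by
      rintro ⟨x, hx⟩
      obtain ⟨t, rfl⟩ := Submodule.mem_span_singleton.1 hx
      rw [LinearPMap.mkSpanSingleton'_apply]
      rcases lt_or_ge 0 t with ht | ht
      · simp [p_smul t ht]
      · exact (mul_nonpos_of_nonpos_of_nonneg ht ENNReal.toReal_nonneg).trans
          ENNReal.toReal_nonneg)
  have hL1 : L e = p e :=
    (hLe ⟨e, Submodule.mem_span_singleton_self e⟩).trans
      (LinearPMap.mkSpanSingleton_apply ℝ ℝ he0 (p e))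
  let Λ : C_c(Y, ℝ) →ₚ[ℝ] ℝ := PositiveLinearMap.mk₀ L fun g hg => by
    have h1 := hLp (-g)
    rw [p_nonpos fun x => by simpa using hg x, map_neg] at h1
    linarith
  have hΛ (g : C_c(Y, ℝ)) : Λ g = L g := rfl
  have hΛe : ENNReal.ofReal (Λ e) = fracCover U a (fun _ => 1) := by
    rw [hΛ, hL1]
    exact ENNReal.ofReal_toReal (hfin e)
  refine ⟨RealRMK.rieszMeasure Λ, le_antisymm ?_ ?_, fun i => ?_⟩
  · rw [← hΛe]
    exact RealRMK.rieszMeasure_le_of_eq_one Λ (fun x => by simp [he]) isCompact_univ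
      fun x _ => he x
  · rw [← hΛe]
    exact RealRMK.le_rieszMeasure_tsupport_subset Λ (fun x => by simp [he]) (subset_univ _)
  · rw [(hU i).measure_eq_iSup_isCompact]
    refine iSup₂_le fun F hF => iSup_le fun hFc => ?_
    obtain ⟨g, hg1, hg0, -, hg⟩ := exists_continuous_one_zero_of_isCompact hFc
      (hU i).isClosed_compl (disjoint_compl_right_iff_subset.2 hF)
    let g' : C_c(Y, ℝ) := CompactlySupportedContinuousMap.continuousMapEquiv g
    have hg' (x : Y) : g' x = g x := rfl
    calc RealRMK.rieszMeasure Λ F ≤ ENNReal.ofReal (Λ g') :=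
          RealRMK.rieszMeasure_le_of_eq_one Λ (fun x => (hg x).1) hFc fun x hx => hg1 hx
      _ ≤ ENNReal.ofReal (p g') := ENNReal.ofReal_le_ofReal (hLp g')
      _ = fracCover U a g' := ENNReal.ofReal_toReal (hfin g')
      _ ≤ a i := fracCover_le_of_indicator i (fun x => (hg x).2) fun x hx => (hg0 hx).le

end FracCover

namespace NDS

variable {X : ℕ → Type*} [∀ k, MetricSpace (X k)] {T : ∀ k, X k → X (k + 1)}

lemma continuous_iter (hT : ∀ k, Continuous (T k)) : ∀ j, Continuous (iter T j)
  | 0 => continuous_id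
  | j + 1 => (hT j).comp (continuous_iter hT j)

lemma isOpen_bowenBall (hT : ∀ k, Continuous (T k)) (n : ℕ) (ε : ℝ) (x : X 0) :
    IsOpen (bowenBall T n ε x) := by
  have h : bowenBall T n ε x = ⋂ j ∈ Iio n, {y | dist (iter T j x) (iter T j y) < ε} := by
    ext; simp [bowenBall]
  rw [h]
  exact (finite_Iio n).isOpen_biInter fun j _ =>
    isOpen_lt (continuous_const.dist (continuous_iter hT j)) continuous_const

lemma mem_bowenBall_self (n : ℕ) {ε : ℝ} (hε : 0 < ε) (x : X 0) : x ∈ bowenBall T n ε x :=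
  fun j _ => by simpa using hε

/-- Fractional covers of `K` by Bowen balls are competitors in the definition of `wBowenPre`. -/
lemma wBowenPre_le_fracCover (f : ∀ k, X k → ℝ) (K : Set (X 0)) (s : ℝ) (N : ℕ) (ε : ℝ) :
    wBowenPre T f s N ε (K.indicator fun _ => (1 : ℝ)) ≤
      fracCover (fun p : {p : X 0 × ℕ // N ≤ p.2} =>
          ((↑) : K → X 0) ⁻¹' bowenBall T p.1.2 ε p.1.1)
        (fun p => ENNReal.ofReal
          (Real.exp (-(p.1.2 : ℝ) * s + supBirk T f p.1.2 (bowenBall T p.1.2 ε p.1.1))))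
        (fun _ => 1) := by
  refine le_iInf₂ fun c hc => ?_
  by_cases hfin : ∑' p, c p * ENNReal.ofReal (Real.exp
      (-(p.1.2 : ℝ) * s + supBirk T f p.1.2 (bowenBall T p.1.2 ε p.1.1))) = ⊤
  · exact hfin ▸ le_top
  have hc_top (p) : c p ≠ ⊤ := fun hp => ENNReal.ne_top_of_tsum_ne_top hfin p <| by
    rw [hp, ENNReal.top_mul (by simp [Real.exp_pos])]
  have hcount : c.support.Countable := by
    refine (Summable.countable_support_ennreal hfin).mono fun p hp => ?_
    simpa [Real.exp_pos] using hp
  let φ : {p : X 0 × ℕ // N ≤ p.2} → (X 0 × ℕ) × ℝ := fun p => (p.1, (c p).toReal)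
  have hφ : InjOn φ c.support := fun p _ q _ h => Subtype.ext (congrArg Prod.fst h)
  have hsum (F : (X 0 × ℕ) × ℝ → ℝ≥0∞) (G : {p : X 0 × ℕ // N ≤ p.2} → ℝ≥0∞)
      (hFG : ∀ p, F (φ p) = G p) (hG : ∀ p, c p = 0 → G p = 0) :
      ∑' q : (φ '' c.support : Set _), F q = ∑' p, G p := by
    rw [tsum_image F hφ]
    simp_rw [hFG]
    exact tsum_subtype_eq_of_support_subset fun p hp h => hp (hG p h)
  refine (iInf₂_le (φ '' c.support) (hcount.image φ)).trans <| (iInf₂_le ?_ ?_).trans ?_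
  · rintro _ ⟨p, hp, rfl⟩
    exact ⟨p.2, ENNReal.toReal_pos hp (hc_top p)⟩
  · intro x
    by_cases hx : x ∈ K
    · rw [hsum (fun q => (bowenBall T q.1.2 ε q.1.1).indicator
          (fun _ => ENNReal.ofReal q.2) x)
        (fun p => (bowenBall T p.1.2 ε p.1.1).indicator (fun _ => c p) x)
        (fun p => by simp [φ, ENNReal.ofReal_toReal (hc_top p)])
        (fun p hp => by simp [hp])]
      rw [indicator_of_mem hx]
      exact hc ⟨x, hx⟩
    · simp [hx]
  · exact (hsum (fun q => ENNReal.ofReal q.2 * ENNReal.ofReal (Real.exp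
        (-(q.1.2 : ℝ) * s + supBirk T f q.1.2 (bowenBall T q.1.2 ε q.1.1)))) _
      (fun p => by simp [φ, ENNReal.ofReal_toReal (hc_top p)])
      (fun p hp => by simp [hp])).le

end NDS

open NDS in
/-- A dynamical Frostman lemma.
If `K ⊆ X 0` is a non-empty compact set and `W^s_{N,ε}(T,f,χ_K) > 0`, then there
exist a Borel probability measure `μ` on `X 0` and a constant `C > 0` (one may take
`C = W^s_{N,ε}(T,f,χ_K)`) such that `μ(K) = 1` and for all `x ∈ X 0` and `n ≥ N`,
`μ(B_n^T(x,ε)) ≤ (1/C) exp(-s n + sup_{y ∈ B_n^T(x,ε)} S_n^T f(y))`. -/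
theorem stmt18 {X : ℕ → Type*} [∀ k, MetricSpace (X k)] [∀ k, CompactSpace (X k)]
    [MeasurableSpace (X 0)] [BorelSpace (X 0)]
    (T : ∀ k, X k → X (k + 1)) (hT : ∀ k, Continuous (T k))
    (f : ∀ k, X k → ℝ) (hf : ∀ k, Continuous (f k))
    (K : Set (X 0)) (hK : IsCompact K) (hKne : K.Nonempty)
    (s : ℝ) (N : ℕ) (hN : 0 < N) (ε : ℝ) (hε : 0 < ε)
    (hW : 0 < wBowenPre T f s N ε (K.indicator fun _ => (1 : ℝ))) :
    ∃ (μ : MeasureTheory.Measure (X 0)) (_ : MeasureTheory.IsProbabilityMeasure μ) (C : ℝ),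
      0 < C ∧ μ K = 1 ∧
      ∀ (x : X 0) (n : ℕ), N ≤ n →
        μ (bowenBall T n ε x) ≤
          ENNReal.ofReal
            ((1 / C) * Real.exp (-s * n + supBirk T f n (bowenBall T n ε x))) := by
  have : CompactSpace K := isCompact_iff_compactSpace.1 hK
  have : Nonempty K := hKne.to_subtype
  let U : {p : X 0 × ℕ // N ≤ p.2} → Set K := fun p => (↑) ⁻¹' bowenBall T p.1.2 ε p.1.1
  let a : {p : X 0 × ℕ // N ≤ p.2} → ℝ≥0∞ := fun p => ENNReal.ofReal
    (Real.exp (-(p.1.2 : ℝ) * s + supBirk T f p.1.2 (bowenBall T p.1.2 ε p.1.1)))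
  have hU (p) : IsOpen (U p) := (isOpen_bowenBall hT _ _ _).preimage continuous_subtype_val
  have hcov : ⋃ p, U p = univ := eq_univ_of_forall fun x =>
    mem_iUnion.2 ⟨⟨(x, N), le_rfl⟩, mem_bowenBall_self N hε (x : X 0)⟩
  have ha (p) : a p ≠ ⊤ := ENNReal.ofReal_ne_top
  obtain ⟨ν, hν, hνU⟩ := exists_measure_univ_eq_fracCover hU hcov ha
  set W := fracCover U a (fun _ => 1)
  have hW0 : W ≠ 0 := (hW.trans_le (wBowenPre_le_fracCover f K s N ε)).ne'
  have hWtop : W ≠ ⊤ := fracCover_ne_top hU hcov ha continuous_const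
  have hmap {A : Set (X 0)} (hA : MeasurableSet A) :
      (W⁻¹ • ν.map ((↑) : K → X 0)) A = W⁻¹ * ν ((↑) ⁻¹' A) := by
    rw [Measure.smul_apply, Measure.map_apply measurable_subtype_coe hA, smul_eq_mul]
  refine ⟨W⁻¹ • ν.map (↑), ⟨?_⟩, W.toReal, ENNReal.toReal_pos hW0 hWtop, ?_, fun x n hn => ?_⟩
  · rw [hmap MeasurableSet.univ, preimage_univ, hν, ENNReal.inv_mul_cancel hW0 hWtop]
  · rw [hmap hK.measurableSet, Subtype.coe_preimage_self, hν, ENNReal.inv_mul_cancel hW0 hWtop]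
  · rw [hmap (isOpen_bowenBall hT _ _ _).measurableSet, ENNReal.ofReal_mul (by positivity),
      one_div, ENNReal.ofReal_inv_of_pos (ENNReal.toReal_pos hW0 hWtop),
      ENNReal.ofReal_toReal hWtop, neg_mul, mul_comm s, ← neg_mul]
    gcongr
    exact hνU ⟨(x, n), hn⟩
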